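/- Let μ > 0, h > 0 and n ∈ ℕ. For x = (x₁,x₂), y = (y₁,y₂) ∈ ℝ² define K_n(x,y) = ∫_ℝ Υ_n(√(μ/h)·(x₂ − hξ/μ)) · Υ_n(√(μ/h)·(y₂ − hξ/μ)) · e^{iξ(x₁−y₁)} dξ; the integral converges absolutely. Then the phase-corrected kernel G_n(x,y) = e^{−iμ(x₂+y₂)(x₁−y₁)/(2h)}·K_n(x,y) depends only on the Euclidean distance |x − y|: for all x, y, x', y' ∈ ℝ² with |x − y| = |x' − y'| one has G_n(x,y) = G_n(x',y'). -/

import Mathlib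

open Real Complex MeasureTheory

/-- Physicists' Hermite polynomials as real functions:
`H 0 = 1`, `H (n+1) s = 2 s · H n s − (H n)' s`. -/
noncomputable def physHermite : ℕ → (ℝ → ℝ)
  | 0 => fun _ => 1
  | n + 1 => fun s => 2 * s * physHermite n s - deriv (physHermite n) s

/-- The (unnormalized) `n`-th Hermite function `Υ_n(s) = H_n(s) e^{−s²/2}`. -/
noncomputable def hermiteFun (n : ℕ) (s : ℝ) : ℝ :=
  physHermite n s * Real.exp (-s ^ 2 / 2)

noncomputable def hpR : ℕ → Polynomial ℝ
  | 0 => 1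
  | n + 1 => 2 * Polynomial.X * hpR n - Polynomial.derivative (hpR n)

noncomputable def hpC : ℕ → Polynomial ℂ
  | 0 => 1
  | n + 1 => 2 * Polynomial.X * hpC n - Polynomial.derivative (hpC n)

lemma physHermite_eq (n : ℕ) : physHermite n = fun s => (hpR n).eval s := by
  induction n with
  | zero => funext s; simp [physHermite, hpR]
  | succ n ih =>
    funext s
    simp [physHermite, hpR, ih]

lemma hpC_eq (n : ℕ) : hpC n = (hpR n).map Complex.ofRealHom := by
  induction n with
  | zero => simp [hpC, hpR]
  | succ n ih => simp [hpC, hpR, ih, Polynomial.derivative_map]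

lemma physHermite_cast (n : ℕ) (s : ℝ) : ((physHermite n s : ℝ) : ℂ) = (hpC n).eval (s : ℂ) := by
  rw [physHermite_eq, hpC_eq]
  have := Polynomial.eval_map_apply (f := Complex.ofRealHom) (p := hpR n) s
  simpa using this.symm

lemma hpC_deriv (n : ℕ) : Polynomial.derivative (hpC (n + 1)) =
    Polynomial.C (2 * ((n : ℂ) + 1)) * hpC n := by
  induction n with
  | zero => simp [hpC]; rfl
  | succ n ih =>
    have e : hpC (n + 2) = 2 * Polynomial.X * hpC (n + 1) - Polynomial.derivative (hpC (n + 1)) := rfl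
    have e1 : hpC (n + 1) = 2 * Polynomial.X * hpC n - Polynomial.derivative (hpC n) := rfl
    have h2 : Polynomial.derivative (2 : Polynomial ℂ) = 0 := by simp
    rw [e, Polynomial.derivative_sub, Polynomial.derivative_mul, Polynomial.derivative_mul, ih, h2,
      Polynomial.derivative_C_mul]
    simp only [Polynomial.derivative_X, map_mul, map_add, map_one, Nat.cast_add, Nat.cast_one]
    have e2 : (Polynomial.C (2:ℂ)) = 2 := rfl
    rw [e2, e1]
    ring

/-- shifted Hermite polynomial -/
noncomputable def hs (n : ℕ) (z : ℂ) : Polynomial ℂ := (hpC n).comp (Polynomial.X + Polynomial.C z)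

lemma hs_zero (z : ℂ) : hs 0 z = 1 := by simp [hs, hpC]

lemma hs_succ (n : ℕ) (z : ℂ) : hs (n + 1) z =
    2 * (Polynomial.X + Polynomial.C z) * hs n z - Polynomial.derivative (hs n z) := by
  simp [hs, hpC, Polynomial.derivative_comp]

lemma hs_deriv (n : ℕ) (z : ℂ) : Polynomial.derivative (hs (n + 1) z) =
    Polynomial.C (2 * ((n : ℂ) + 1)) * hs n z := by
  unfold hs
  rw [Polynomial.derivative_comp, hpC_deriv]
  simp

lemma M_rec (M : Polynomial ℂ →ₗ[ℂ] ℂ)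
    (hM : ∀ q, M (Polynomial.derivative q - 2 * Polynomial.X * q) = 0) (n : ℕ) (z : ℂ)
    (q : Polynomial ℂ) : M (hs (n + 1) z * q) =
      2 * z * M (hs n z * q) + M (hs n z * Polynomial.derivative q) := by
  have h := hM (hs n z * q)
  have e : hs (n + 1) z * q = (2 * z) • (hs n z * q) + hs n z * Polynomial.derivative q
      - (Polynomial.derivative (hs n z * q) - 2 * Polynomial.X * (hs n z * q)) := by
    rw [hs_succ, Polynomial.derivative_mul, Polynomial.smul_eq_C_mul, map_mul]
    have e2 : (Polynomial.C (2:ℂ)) = 2 := rfl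
    rw [e2]; ring
  rw [e, map_sub, h, map_add, map_smul, smul_eq_mul, sub_zero]

lemma M_radial (n : ℕ) : ∃ D E : ℂ → ℂ, ∀ (M : Polynomial ℂ →ₗ[ℂ] ℂ),
    (∀ q, M (Polynomial.derivative q - 2 * Polynomial.X * q) = 0) → ∀ z w : ℂ,
    M (hs n z * hs n w) = D (z * w) * M 1 ∧
    M (hs n z * hs (n + 1) w) = 2 * w * E (z * w) * M 1 := by
  induction n with
  | zero =>
    refine ⟨fun _ => 1, fun _ => 1, fun M hM z w => ?_⟩
    refine ⟨by simp [hs_zero], ?_⟩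
    rw [mul_comm, M_rec M hM]
    simp [hs_zero]
  | succ n ih =>
    obtain ⟨D, E, ih⟩ := ih
    refine ⟨fun t => 4 * t * E t + 2 * (n + 1) * D t,
      fun t => (4 * t * E t + 2 * (n + 1) * D t) + 2 * (n + 1) * E t, fun M hM z w => ?_⟩
    obtain ⟨h1, h2⟩ := ih M hM z w
    have key : M (hs (n + 1) z * hs (n + 1) w) =
        (4 * (z * w) * E (z * w) + 2 * (n + 1) * D (z * w)) * M 1 := by
      rw [M_rec M hM, hs_deriv, mul_left_comm, ← Polynomial.smul_eq_C_mul, map_smul, h1, h2,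
        smul_eq_mul]
      ring
    refine ⟨key, ?_⟩
    rw [mul_comm, M_rec M hM, hs_deriv, mul_left_comm, ← Polynomial.smul_eq_C_mul, map_smul,
      mul_comm (hs (n + 1) w) (hs (n + 1) z), key, mul_comm (hs (n + 1) w) (hs n z), h2,
      smul_eq_mul]
    ring

lemma gauss_integrable (p : Polynomial ℂ) (b : ℝ) :
    Integrable (fun s : ℝ => p.eval (s : ℂ) * Complex.exp (-(s:ℂ)^2 - 2 * I * b * s)) := by
  induction p using Polynomial.induction_on' with
  | add p q hp hq =>
    simp only [Polynomial.eval_add, add_mul]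
    exact hp.add hq
  | monomial k c =>
    have h := integrable_rpow_mul_exp_neg_mul_sq (b := 1) one_pos (s := k)
      (by have : (0:ℝ) ≤ k := Nat.cast_nonneg k
          linarith)
    have h' := (h.ofReal (𝕜 := ℂ)).const_mul c
    refine h'.mono (by simp only [Polynomial.eval_monomial]; fun_prop) (ae_of_all _ fun s => ?_)
    simp [Complex.norm_exp, ← Complex.ofReal_pow, Real.rpow_natCast, mul_assoc]

/-- Gaussian functional -/
noncomputable def gM (b : ℝ) : Polynomial ℂ →ₗ[ℂ] ℂ where
  toFun q := ∫ s : ℝ, (q.comp (Polynomial.X + Polynomial.C (I * b))).eval (s : ℂ) *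
    Complex.exp (-(s:ℂ)^2 - 2 * I * b * s)
  map_add' p q := by
    rw [← integral_add (gauss_integrable _ b) (gauss_integrable _ b)]
    simp only [Polynomial.add_comp, Polynomial.eval_add, add_mul]
  map_smul' c q := by
    simp only [Polynomial.smul_comp, Polynomial.eval_smul, smul_eq_mul, RingHom.id_apply, mul_assoc]
    rw [integral_const_mul]

lemma gM_apply (b : ℝ) (q : Polynomial ℂ) : gM b q =
    ∫ s : ℝ, (q.comp (Polynomial.X + Polynomial.C (I * b))).eval (s : ℂ) *
    Complex.exp (-(s:ℂ)^2 - 2 * I * b * s) := rfl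

lemma gM_zero (b : ℝ) (q : Polynomial ℂ) :
    gM b (Polynomial.derivative q - 2 * Polynomial.X * q) = 0 := by
  rw [gM_apply]
  refine integral_eq_zero_of_hasDerivAt_of_integrable
    (f := fun s : ℝ => (q.comp (Polynomial.X + Polynomial.C (I * b))).eval (s : ℂ) *
    Complex.exp (-(s:ℂ)^2 - 2 * I * b * s)) (fun s => ?_) (gauss_integrable _ b)
    (gauss_integrable _ b)
  have h1 := (q.comp (Polynomial.X + Polynomial.C (I * b))).hasDerivAt (s : ℂ)
  have h2 : HasDerivAt (fun s : ℂ => Complex.exp (-s^2 - 2 * I * b * s))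
      (Complex.exp (-(s:ℂ)^2 - 2 * I * b * s) * (-(2 * s) - 2 * I * b)) (s:ℂ) := by
    have := ((hasDerivAt_pow 2 (s:ℂ)).neg.sub ((hasDerivAt_id (s:ℂ)).const_mul (2 * I * b))).cexp
    simpa using this
  have h3 := (h1.mul h2).comp_ofReal
  refine h3.congr_deriv ?_
  simp [Polynomial.derivative_comp]
  ring

lemma gM_one (b : ℝ) : gM b 1 = (π : ℂ) ^ (1 / 2 : ℂ) * Complex.exp (-(b:ℂ)^2) := by
  rw [gM_apply]
  have := integral_cexp_quadratic (b := -1) (by simp) (-2 * I * b) 0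
  convert this using 2
  · funext s
    simp [sub_eq_add_neg]
  · simp
  · congr 1
    ring_nf
    simp

noncomputable def gfun (n : ℕ) (a b : ℝ) (s : ℝ) : ℂ :=
  ((hermiteFun n (s + a) : ℝ) : ℂ) * ((hermiteFun n (s - a) : ℝ) : ℂ) * Complex.exp (-2 * I * b * s)

lemma gfun_eq (n : ℕ) (a b s : ℝ) : gfun n a b s = Complex.exp (-(a:ℂ)^2) *
    (((hs n (a - I * b) * hs n (-a - I * b)).comp
      (Polynomial.X + Polynomial.C (I * b))).eval (s : ℂ) *
      Complex.exp (-(s:ℂ)^2 - 2 * I * b * s)) := by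
  unfold gfun hermiteFun
  push_cast
  rw [physHermite_cast, physHermite_cast]
  have e : Polynomial.eval (s : ℂ) ((hs n (a - I * b) * hs n (-a - I * b)).comp
      (Polynomial.X + Polynomial.C (I * b))) =
      (hpC n).eval ((s + a : ℝ) : ℂ) * (hpC n).eval ((s - a : ℝ) : ℂ) := by
    simp only [hs, Polynomial.mul_comp, Polynomial.eval_mul, Polynomial.eval_comp,
      Polynomial.eval_add, Polynomial.eval_X, Polynomial.eval_C]
    push_cast
    congr 2 <;> ring
  rw [e]
  have e2 : Complex.exp (-(a:ℂ)^2) * Complex.exp (-(s:ℂ)^2 - 2 * I * b * s) =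
      Complex.exp (-((s:ℂ)+a)^2/2) * Complex.exp (-((s:ℂ)-a)^2/2) * Complex.exp (-2 * I * b * s) := by
    simp only [← Complex.exp_add]
    congr 1
    ring
  linear_combination (-(hpC n).eval ((s + a : ℝ) : ℂ) * (hpC n).eval ((s - a : ℝ) : ℂ)) * e2

lemma gfun_integrable (n : ℕ) (a b : ℝ) : Integrable (gfun n a b) := by
  have : gfun n a b = _ := funext fun s => gfun_eq n a b s
  rw [this]
  exact (gauss_integrable _ b).const_mul _

lemma gfun_integral (n : ℕ) : ∃ F : ℝ → ℂ, ∀ a b : ℝ, ∫ s, gfun n a b s = F (a^2 + b^2) := by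
  obtain ⟨D, E, h⟩ := M_radial n
  refine ⟨fun t => D (-t) * (π : ℂ) ^ (1 / 2 : ℂ) * Complex.exp (-t), fun a b => ?_⟩
  simp only [gfun_eq]
  rw [integral_const_mul, ← gM_apply, (h (gM b) (gM_zero b) _ _).1, gM_one]
  have e : ((a:ℂ) - I * b) * (-a - I * b) = -((a^2 + b^2 : ℝ) : ℂ) := by
    push_cast
    linear_combination (b:ℂ)^2 * I_sq
  rw [e]
  have e2 : Complex.exp (-((a^2 + b^2 : ℝ) : ℂ)) = Complex.exp (-(a:ℂ)^2) * Complex.exp (-(b:ℂ)^2) := by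
    rw [← Complex.exp_add]; push_cast; congr 1; ring
  rw [e2]
  ring

lemma integrand_eq (μ h : ℝ) (hμ : 0 < μ) (hh : 0 < h) (n : ℕ) (x₁ x₂ y₁ y₂ ξ : ℝ) :
    ((hermiteFun n (Real.sqrt (μ / h) * (x₂ - h * ξ / μ)) : ℝ) : ℂ) *
        ((hermiteFun n (Real.sqrt (μ / h) * (y₂ - h * ξ / μ)) : ℝ) : ℂ) *
        Complex.exp (Complex.I * (ξ : ℂ) * ((x₁ - y₁ : ℝ) : ℂ)) =
    Complex.exp (I * μ * ((x₂ + y₂ : ℝ) : ℂ) * ((x₁ - y₁ : ℝ) : ℂ) / (2 * (h : ℂ))) *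
      gfun n (√(μ / h) * (x₂ - y₂) / 2) (√(μ / h) * (x₁ - y₁) / 2)
        (√(μ / h) * (x₂ + y₂) / 2 - (√(μ / h))⁻¹ * ξ) := by
  have hk : 0 < √(μ / h) := Real.sqrt_pos.2 (div_pos hμ hh)
  have hk2 : √(μ / h) ^ 2 = μ / h := Real.sq_sqrt (div_pos hμ hh).le
  generalize √(μ / h) = k at *
  have hμ' : μ = k ^ 2 * h := by rw [hk2]; field_simp
  subst hμ'
  have a1 : k * (x₂ + y₂) / 2 - k⁻¹ * ξ + k * (x₂ - y₂) / 2 = k * (x₂ - h * ξ / (k^2*h)) := by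
    field_simp; ring
  have a2 : k * (x₂ + y₂) / 2 - k⁻¹ * ξ - k * (x₂ - y₂) / 2 = k * (y₂ - h * ξ / (k^2*h)) := by
    field_simp; ring
  unfold gfun
  rw [a1, a2, mul_left_comm, ← Complex.exp_add]
  congr 2
  have hkc : (k : ℂ) ≠ 0 := by exact_mod_cast hk.ne'
  have hhc : (h : ℂ) ≠ 0 := by exact_mod_cast hh.ne'
  push_cast
  field_simp
  ring


/-- The Landau-band kernel
`K_n(x,y) = ∫_ℝ Υ_n(√(μ/h)(x₂ − hξ/μ))·Υ_n(√(μ/h)(y₂ − hξ/μ))·e^{iξ(x₁−y₁)} dξ`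
converges absolutely, and the phase-corrected kernel
`G_n(x,y) = e^{−iμ(x₂+y₂)(x₁−y₁)/(2h)}·K_n(x,y)` depends only on the Euclidean
distance `|x − y|`. -/
theorem landau_band_kernel_radial
    (μ h : ℝ) (hμ : 0 < μ) (hh : 0 < h) (n : ℕ)
    (K G : ℝ → ℝ → ℝ → ℝ → ℂ)
    (hK : ∀ x₁ x₂ y₁ y₂ : ℝ, K x₁ x₂ y₁ y₂ =
      ∫ ξ : ℝ, ((hermiteFun n (Real.sqrt (μ / h) * (x₂ - h * ξ / μ)) : ℝ) : ℂ) *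
        ((hermiteFun n (Real.sqrt (μ / h) * (y₂ - h * ξ / μ)) : ℝ) : ℂ) *
        Complex.exp (Complex.I * (ξ : ℂ) * ((x₁ - y₁ : ℝ) : ℂ)))
    (hG : ∀ x₁ x₂ y₁ y₂ : ℝ, G x₁ x₂ y₁ y₂ =
      Complex.exp (-Complex.I * (μ : ℂ) * ((x₂ + y₂ : ℝ) : ℂ) * ((x₁ - y₁ : ℝ) : ℂ) /
          (2 * (h : ℂ))) * K x₁ x₂ y₁ y₂) :
    (∀ x₁ x₂ y₁ y₂ : ℝ, MeasureTheory.Integrable (fun ξ : ℝ =>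
        ((hermiteFun n (Real.sqrt (μ / h) * (x₂ - h * ξ / μ)) : ℝ) : ℂ) *
        ((hermiteFun n (Real.sqrt (μ / h) * (y₂ - h * ξ / μ)) : ℝ) : ℂ) *
        Complex.exp (Complex.I * (ξ : ℂ) * ((x₁ - y₁ : ℝ) : ℂ)))) ∧
    (∀ x₁ x₂ y₁ y₂ x₁' x₂' y₁' y₂' : ℝ,
      (x₁ - y₁) ^ 2 + (x₂ - y₂) ^ 2 = (x₁' - y₁') ^ 2 + (x₂' - y₂') ^ 2 →
      G x₁ x₂ y₁ y₂ = G x₁' x₂' y₁' y₂') := by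
  constructor
  · intro x₁ x₂ y₁ y₂
    simp only [integrand_eq μ h hμ hh]
    have hk : 0 < √(μ / h) := Real.sqrt_pos.2 (div_pos hμ hh)
    refine Integrable.const_mul ?_ _
    exact ((gfun_integrable n (√(μ / h) * (x₂ - y₂) / 2) (√(μ / h) * (x₁ - y₁) / 2)).comp_sub_left
      (√(μ / h) * (x₂ + y₂) / 2)).comp_mul_left' (inv_ne_zero hk.ne')
  · obtain ⟨F, hF⟩ := gfun_integral n
    have main : ∀ x₁ x₂ y₁ y₂ : ℝ, G x₁ x₂ y₁ y₂ =
        |√(μ / h)| • F (μ / h * ((x₁ - y₁) ^ 2 + (x₂ - y₂) ^ 2) / 4) := by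
      intro x₁ x₂ y₁ y₂
      rw [hG, hK]
      simp only [integrand_eq μ h hμ hh]
      rw [integral_const_mul, ← mul_assoc, ← Complex.exp_add]
      rw [show ∀ u v w d : ℂ, -I * u * v * w / d + I * u * v * w / d = 0 by intros; ring,
        Complex.exp_zero, one_mul]
      rw [Measure.integral_comp_mul_left (fun t => gfun n (√(μ / h) * (x₂ - y₂) / 2)
        (√(μ / h) * (x₁ - y₁) / 2) (√(μ / h) * (x₂ + y₂) / 2 - t)),
        integral_sub_left_eq_self (gfun n (√(μ / h) * (x₂ - y₂) / 2)
        (√(μ / h) * (x₁ - y₁) / 2)), hF, inv_inv]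
      have hk2 : √(μ / h) ^ 2 = μ / h := Real.sq_sqrt (div_pos hμ hh).le
      congr 2
      linear_combination (((x₁ - y₁) ^ 2 + (x₂ - y₂) ^ 2) / 4) * hk2
    intro x₁ x₂ y₁ y₂ x₁' x₂' y₁' y₂' hd
    rw [main, main, hd]
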